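/- Let ϑ > 0, γ̃ ∈ (0, 1/2), and let g : [0,∞)×[0,1] → ℝ be continuous with g(s,0) = g(s,1) = 0 for all s and with sup_{s,x} |g(s,x)| ≤ B and |g(s,x) − g(s,y)| ≤ B·|x − y|^{γ̃} for all s ≥ 0 and x, y ∈ [0,1]. Then for every x ∈ (0,1) the function t ↦ N(t,x) is differentiable at every t > 0, with derivative ∂ₜN(t,x) = g(t,x) + ϑ·∂²ₓN(t,x). -/

import Mathlib

open Real MeasureTheory

/-- The sine basis functions `e_ℓ(x) = √2 sin(πℓx)`. -/
noncomputable def sineB (ℓ : ℕ) (x : ℝ) : ℝ := Real.sqrt 2 * Real.sin (Real.pi * ℓ * x)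

/-- Fourier sine coefficients `c_ℓ(s) = ∫₀¹ g(s,y) e_ℓ(y) dy`. -/
noncomputable def fCoef (g : ℝ → ℝ → ℝ) (ℓ : ℕ) (s : ℝ) : ℝ :=
  ∫ y in (0 : ℝ)..1, g s y * sineB ℓ y

/-- The heat convolution `N(t,x) = ∫₀ᵗ ∑_{ℓ≥1} e^{−λ_ℓ(t−s)} c_ℓ(s) e_ℓ(x) ds`,
where `λ_ℓ = ϑπ²ℓ²`. -/
noncomputable def heatConv (ϑ : ℝ) (g : ℝ → ℝ → ℝ) (t x : ℝ) : ℝ :=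
  ∫ s in (0 : ℝ)..t,
    ∑' ℓ : ℕ, Real.exp (-(ϑ * Real.pi ^ 2 * ((ℓ : ℝ) + 1) ^ 2 * (t - s)))
      * fCoef g (ℓ + 1) s * sineB (ℓ + 1) x

noncomputable def hk (k z : ℝ) : ℝ := (√(4 * π * k))⁻¹ * Real.exp (-(z ^ 2 / (4 * k)))
noncomputable def hk1 (k z : ℝ) : ℝ := -(z / (2 * k)) * hk k z
noncomputable def hk2 (k z : ℝ) : ℝ := (z ^ 2 / (4 * k ^ 2) - 1 / (2 * k)) * hk k z

lemma hk_deriv (k z : ℝ) (hk0 : 0 < k) : HasDerivAt (hk k) (hk1 k z) z := by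
  have h : HasDerivAt (fun z : ℝ => -(z ^ 2 / (4 * k))) (-(2 * z / (4 * k))) z := by
    have := ((hasDerivAt_pow 2 z).div_const (4 * k)).neg
    refine this.congr_deriv ?_
    norm_num
  have := (h.exp).const_mul ((√(4 * π * k))⁻¹)
  refine this.congr_deriv ?_
  simp only [hk1, hk]
  field_simp
  ring

lemma hk1_deriv (k z : ℝ) (hk0 : 0 < k) : HasDerivAt (hk1 k) (hk2 k z) z := by
  have h : HasDerivAt (fun z : ℝ => -(z / (2 * k))) (-(1 / (2 * k))) z :=
    ((hasDerivAt_id z).div_const (2 * k)).neg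
  have := h.mul (hk_deriv k z hk0)
  refine this.congr_deriv ?_
  simp only [hk2, hk1]
  field_simp
  ring

lemma hk_deriv_k (k z : ℝ) (hk0 : 0 < k) : HasDerivAt (fun k => hk k z) (hk2 k z) k := by
  have h1 : HasDerivAt (fun k : ℝ => 4 * π * k) (4 * π) k := by
    simpa using (hasDerivAt_id k).const_mul (4 * π)
  have hp : 0 < 4 * π * k := by positivity
  have h2 := (h1.sqrt hp.ne').inv (Real.sqrt_pos.2 hp).ne'
  have h3 : HasDerivAt (fun k : ℝ => -(z ^ 2 / (4 * k))) (z ^ 2 / (4 * k ^ 2)) k := by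
    have h4 : HasDerivAt (fun k : ℝ => 4 * k) 4 k := by
      simpa using (hasDerivAt_id k).const_mul (4 : ℝ)
    have := ((h4.inv (by positivity)).const_mul (z ^ 2)).neg
    refine this.congr_deriv ?_
    field_simp
  have := h2.mul h3.exp
  refine this.congr_deriv ?_
  simp only [hk2, hk, Pi.inv_apply]
  have hs : √(4 * π * k) ^ 2 = 4 * π * k := Real.sq_sqrt hp.le
  rw [hs]
  have : √(4 * π * k) ≠ 0 := (Real.sqrt_pos.2 hp).ne'
  field_simp
  ring

lemma gauss_dom (b : ℝ) (hb : 0 < b) :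
    ∃ C, 0 ≤ C ∧ ∀ z : ℝ, (1 + z ^ 2) ^ 3 * Real.exp (-(b * z ^ 2)) ≤ C := by
  set c := min 1 (b / 3) with hc
  have hc0 : 0 < c := by positivity
  have hc1 : c ≤ 1 := min_le_left _ _
  have hc2 : c ≤ b / 3 := min_le_right _ _
  refine ⟨(c ^ 3)⁻¹, by positivity, fun z => ?_⟩
  have h1 : c * (1 + z ^ 2) ≤ Real.exp (c * z ^ 2) := by
    have := Real.add_one_le_exp (c * z ^ 2)
    nlinarith
  have h2 : (c * (1 + z ^ 2)) ^ 3 ≤ Real.exp (b * z ^ 2) := by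
    calc (c * (1 + z ^ 2)) ^ 3 ≤ (Real.exp (c * z ^ 2)) ^ 3 := by gcongr
      _ = Real.exp (3 * (c * z ^ 2)) := by rw [← Real.exp_nat_mul]; norm_num
      _ ≤ _ := by
        apply Real.exp_le_exp.2
        nlinarith [sq_nonneg z]
  rw [Real.exp_neg, ← div_eq_mul_inv, div_le_iff₀ (Real.exp_pos _), inv_mul_eq_div,
    le_div_iff₀ (by positivity)]
  calc _ = (c * (1 + z ^ 2)) ^ 3 := by ring
    _ ≤ _ := h2

lemma hk_bounds' (a b : ℝ) (ha : 0 < a) :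
    ∃ C, 0 ≤ C ∧ ∀ k ∈ Set.Icc a b, ∀ z, |hk k z| ≤ C * ((1 + z ^ 2)⁻¹) ^ 2 ∧
      |hk1 k z| ≤ C * ((1 + z ^ 2)⁻¹) ^ 2 ∧ |hk2 k z| ≤ C * ((1 + z ^ 2)⁻¹) ^ 2 := by
  rcases lt_or_ge b a with hab | hab
  · exact ⟨0, le_rfl, fun k hk => absurd (hk.1.trans hk.2) (not_le.2 hab)⟩
  have hb : 0 < b := ha.trans_le hab
  obtain ⟨C, hC, h⟩ := gauss_dom (1 / (4 * b)) (by positivity)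
  set S := (√(4 * π * a))⁻¹
  have hS : 0 ≤ S := by positivity
  set M := 1 + 1 / (2 * a) + 1 / (4 * a ^ 2) with hM
  have hM0 : 0 ≤ M := by positivity
  refine ⟨M * S * C, by positivity, fun k hk' z => ?_⟩
  have hk0 : 0 < k := ha.trans_le hk'.1
  have hz : (0 : ℝ) < 1 + z ^ 2 := by positivity
  have key : |hk k z| ≤ S * C * ((1 + z ^ 2)⁻¹) ^ 3 := by
    unfold hk
    rw [abs_of_nonneg (by positivity), mul_assoc S]
    refine mul_le_mul ?_ ?_ (Real.exp_pos _).le hS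
    · apply inv_anti₀
      · apply Real.sqrt_pos.2; positivity
      · apply Real.sqrt_le_sqrt
        have := hk'.1
        gcongr
    · have := h z
      rw [inv_pow, ← div_eq_mul_inv, le_div_iff₀ (by positivity), mul_comm]
      refine le_trans ?_ this
      gcongr
      rw [one_div_mul_eq_div]
      have := hk'.2
      gcongr
  have hz1 : (1 + z ^ 2)⁻¹ ≤ 1 := inv_le_one_of_one_le₀ (by nlinarith [sq_nonneg z])
  have gen : ∀ m : ℝ, |m| ≤ M * (1 + z ^ 2) → |m * hk k z| ≤ M * S * C * ((1 + z ^ 2)⁻¹) ^ 2 := by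
    intro m hm
    rw [abs_mul]
    calc |m| * |hk k z| ≤ (M * (1 + z ^ 2)) * (S * C * ((1 + z ^ 2)⁻¹) ^ 3) := by
          gcongr
      _ = _ := by field_simp
  have i1 : 1 / (2 * k) ≤ 1 / (2 * a) := by
    have := hk'.1
    gcongr
  have i2 : 1 / (4 * k ^ 2) ≤ 1 / (4 * a ^ 2) := by
    have := hk'.1
    gcongr
  have p1 : 0 < 1 / (2 * k) := by positivity
  have p2 : 0 < 1 / (4 * k ^ 2) := by positivity
  have hzz : |z| ≤ 1 + z ^ 2 := by
    rw [← sq_abs z]; nlinarith [sq_nonneg (|z| - 1)]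
  refine ⟨?_, ?_, ?_⟩
  · rw [← one_mul (hk k z)]
    apply gen
    rw [abs_one]
    have : 1 ≤ M := by rw [hM]; linarith
    nlinarith [sq_nonneg z]
  · apply gen
    rw [abs_neg, div_eq_mul_one_div, abs_mul, abs_of_pos p1, mul_comm]
    have : 1 / (2 * k) ≤ M := by rw [hM]; linarith
    gcongr
  · apply gen
    have e : z ^ 2 / (4 * k ^ 2) = 1 / (4 * k ^ 2) * z ^ 2 := by ring
    rw [e]
    refine (abs_sub _ _).trans ?_
    rw [abs_of_nonneg (by positivity), abs_of_pos p1]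
    have : 1 / (4 * k ^ 2) + 1 / (2 * k) ≤ M := by rw [hM]; linarith
    nlinarith [sq_nonneg z]

lemma hk_bounds (a b : ℝ) (ha : 0 < a) :
    ∃ C, 0 ≤ C ∧ ∀ k ∈ Set.Icc a b, ∀ z, |hk k z| ≤ C * (1 + z ^ 2)⁻¹ ∧
      |hk1 k z| ≤ C * (1 + z ^ 2)⁻¹ ∧ |hk2 k z| ≤ C * (1 + z ^ 2)⁻¹ := by
  obtain ⟨C, hC, h⟩ := hk_bounds' a b ha
  refine ⟨C, hC, fun k hk z => ?_⟩
  have hz1 : (1 + z ^ 2)⁻¹ ≤ 1 := inv_le_one_of_one_le₀ (by nlinarith [sq_nonneg z])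
  have hz0 : 0 ≤ (1 + z ^ 2)⁻¹ := by positivity
  have : C * ((1 + z ^ 2)⁻¹) ^ 2 ≤ C * (1 + z ^ 2)⁻¹ := by
    gcongr
    nlinarith
  obtain ⟨h1, h2, h3⟩ := h k hk z
  exact ⟨h1.trans this, h2.trans this, h3.trans this⟩

lemma hk_meas : Measurable (fun q : ℝ × ℝ => hk q.1 q.2) := by
  unfold hk; fun_prop
lemma hk1_meas : Measurable (fun q : ℝ × ℝ => hk1 q.1 q.2) := by
  unfold hk1 hk; fun_prop
lemma hk2_meas : Measurable (fun q : ℝ × ℝ => hk2 q.1 q.2) := by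
  unfold hk2 hk; fun_prop

lemma int_dom {K : ℝ → ℝ} (hK : Measurable K) {C : ℝ} (h : ∀ z, |K z| ≤ C * (1 + z ^ 2)⁻¹) :
    Integrable K :=
  (integrable_inv_one_add_sq.const_mul C).mono' hK.aestronglyMeasurable
    (Filter.Eventually.of_forall h)

lemma hk_int (k : ℝ) (h0 : 0 < k) : Integrable (hk k) ∧ Integrable (hk1 k) ∧ Integrable (hk2 k) := by
  obtain ⟨C, -, h⟩ := hk_bounds k k h0
  have h := h k ⟨le_rfl, le_rfl⟩
  exact ⟨int_dom (hk_meas.comp measurable_prodMk_left) fun z => (h z).1,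
    int_dom (hk1_meas.comp measurable_prodMk_left) fun z => (h z).2.1,
    int_dom (hk2_meas.comp measurable_prodMk_left) fun z => (h z).2.2⟩

lemma hk_integral (k : ℝ) (h0 : 0 < k) : ∫ z, hk k z = 1 := by
  unfold hk
  rw [integral_const_mul]
  have := integral_gaussian (1 / (4 * k))
  have e : ∀ x : ℝ, -(1 / (4 * k)) * x ^ 2 = -(x ^ 2 / (4 * k)) := fun x => by ring
  simp only [e] at this
  rw [this, show π / (1 / (4 * k)) = 4 * π * k by field_simp]
  exact inv_mul_cancel₀ (Real.sqrt_pos.2 (by positivity)).ne'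

lemma hk2_integral (k : ℝ) (h0 : 0 < k) : ∫ z, hk2 k z = 0 :=
  integral_eq_zero_of_hasDerivAt_of_integrable (fun z => hk1_deriv k z h0) (hk_int k h0).2.2
    (hk_int k h0).2.1

lemma shift_dom {x x0 y : ℝ} (h : |x - x0| < 1) :
    (1 + (x - y) ^ 2)⁻¹ ≤ 3 * (1 + (x0 - y) ^ 2)⁻¹ := by
  rw [← div_eq_mul_inv, le_div_iff₀ (by positivity), inv_mul_le_iff₀ (by positivity)]
  have := abs_lt.1 h
  nlinarith [sq_nonneg ((x - y) + (x - x0)), sq_nonneg (x - y), mul_pos (sub_pos.2 this.1) (sub_pos.2 this.2)]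

lemma conv_int {H K : ℝ → ℝ} {B : ℝ} (hH : Measurable H) (hB : ∀ y, |H y| ≤ B)
    (hKi : Integrable K) (x : ℝ) : Integrable (fun y => H y * K (x - y)) :=
  (hKi.comp_sub_left x).bdd_mul hH.aestronglyMeasurable (Filter.Eventually.of_forall hB)

lemma conv_deriv {H K K' : ℝ → ℝ} {B C : ℝ} (hH : Measurable H) (hB : ∀ y, |H y| ≤ B)
    (hK : ∀ z, HasDerivAt K (K' z) z) (hKi : Integrable K)
    (hKm' : Measurable K') (hC : ∀ z, |K' z| ≤ C * (1 + z ^ 2)⁻¹) (x : ℝ) :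
    HasDerivAt (fun x => ∫ y, H y * K (x - y)) (∫ y, H y * K' (x - y)) x := by
  have hC0 : 0 ≤ C := by
    have := (abs_nonneg _).trans (hC 0); simpa using this
  have hB0 : 0 ≤ B := (abs_nonneg _).trans (hB 0)
  refine (hasDerivAt_integral_of_dominated_loc_of_deriv_le (s := Metric.ball x 1)
    (F := fun x y => H y * K (x - y)) (F' := fun x y => H y * K' (x - y))
    (bound := fun y => B * (C * (3 * (1 + (x - y) ^ 2)⁻¹))) (Metric.ball_mem_nhds x one_pos)
    (Filter.Eventually.of_forall fun z => ?_) (conv_int hH hB hKi x) ?_ ?_ ?_ ?_).2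
  · exact (conv_int hH hB hKi z).aestronglyMeasurable
  · exact (hH.mul (hKm'.comp (by fun_prop))).aestronglyMeasurable
  · refine Filter.Eventually.of_forall fun y z hz => ?_
    rw [Real.norm_eq_abs, abs_mul]
    have := shift_dom (y := y) (Metric.mem_ball.1 hz)
    have h2 := hC (z - y)
    gcongr
    · exact hB y
    · exact h2.trans (by gcongr)
  · exact (((integrable_inv_one_add_sq.comp_sub_left x).const_mul 3).const_mul C).const_mul B
  · refine Filter.Eventually.of_forall fun y z hz => ?_
    have := (hK (z - y)).comp_sub_const z y
    exact this.const_mul (H y)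

lemma conv_deriv_k {H : ℝ → ℝ} {B : ℝ} (hH : Measurable H) (hB : ∀ y, |H y| ≤ B)
    (x k : ℝ) (h0 : 0 < k) :
    HasDerivAt (fun k => ∫ y, H y * hk k (x - y)) (∫ y, H y * hk2 k (x - y)) k := by
  obtain ⟨C, hC0, hC⟩ := hk_bounds (k / 2) (2 * k) (by positivity)
  have hB0 : 0 ≤ B := (abs_nonneg _).trans (hB 0)
  refine (hasDerivAt_integral_of_dominated_loc_of_deriv_le (s := Set.Icc (k / 2) (2 * k))
    (F := fun k y => H y * hk k (x - y)) (F' := fun k y => H y * hk2 k (x - y))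
    (bound := fun y => B * (C * (1 + (x - y) ^ 2)⁻¹)) (Icc_mem_nhds (by linarith) (by linarith))
    (Filter.Eventually.of_forall fun z => ?_) (conv_int hH hB (hk_int k h0).1 x) ?_ ?_ ?_ ?_).2
  · exact (hH.mul (hk_meas.comp (f := fun y => (z, x - y)) (by fun_prop))).aestronglyMeasurable
  · exact (hH.mul (hk2_meas.comp (f := fun y => (k, x - y)) (by fun_prop))).aestronglyMeasurable
  · refine Filter.Eventually.of_forall fun y z hz => ?_
    rw [Real.norm_eq_abs, abs_mul]
    have h2 := (hC z hz (x - y)).2.2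
    gcongr
    exact hB y
  · exact ((integrable_inv_one_add_sq.comp_sub_left x).const_mul C).const_mul B
  · refine Filter.Eventually.of_forall fun y z hz => ?_
    exact (hk_deriv_k z (x - y) (by linarith [hz.1])).const_mul (H y)

lemma hk_scale (k w : ℝ) (h0 : 0 < k) : hk k (√k * w) = k ^ (-(1 / 2) : ℝ) * hk 1 w := by
  have hs : √k ^ 2 = k := Real.sq_sqrt h0.le
  have hs0 : √k ≠ 0 := (Real.sqrt_pos.2 h0).ne'
  have e : k ^ (-(1 / 2) : ℝ) = (√k)⁻¹ := by
    rw [Real.rpow_neg h0.le, Real.sqrt_eq_rpow]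
  rw [e]
  unfold hk
  rw [mul_pow, hs, Real.sqrt_mul (by positivity : (0:ℝ) ≤ 4 * π) k, mul_one,
    show k * w ^ 2 / (4 * k) = w ^ 2 / (4 * 1) by field_simp]
  rw [mul_inv]
  ring

lemma hk1_scale (k w : ℝ) (h0 : 0 < k) : hk1 k (√k * w) = k ^ (-(1 / 2) - 1 / 2 : ℝ) * hk1 1 w := by
  have hs : √k ^ 2 = k := Real.sq_sqrt h0.le
  have hs0 : √k ≠ 0 := (Real.sqrt_pos.2 h0).ne'
  unfold hk1
  rw [hk_scale k w h0, Real.rpow_sub h0, ← Real.sqrt_eq_rpow]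
  have : √k * w / (2 * k) = w / (2 * √k) := by
    rw [div_eq_div_iff (by positivity) (by positivity)]
    calc √k * w * (2 * √k) = √k ^ 2 * (2 * w) := by ring
      _ = _ := by rw [hs]; ring
  rw [this]
  field_simp

lemma hk2_scale (k w : ℝ) (h0 : 0 < k) : hk2 k (√k * w) = k ^ (-1 - 1 / 2 : ℝ) * hk2 1 w := by
  have hs : √k ^ 2 = k := Real.sq_sqrt h0.le
  unfold hk2
  rw [hk_scale k w h0, show (-1 - 1 / 2 : ℝ) = -(1/2) - 1 by norm_num,
    Real.rpow_sub h0, Real.rpow_one, mul_pow, hs]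
  field_simp

lemma scale_int {K : ℝ → ℝ → ℝ} (c a : ℝ) (k : ℝ) (h0 : 0 < k)
    (hK : ∀ w, K k (√k * w) = k ^ (c - 1 / 2) * K 1 w) :
    ∫ z, |z| ^ a * |K k z| = k ^ (a / 2 + c) * ∫ z, |z| ^ a * |K 1 z| := by
  have hs0 : 0 < √k := Real.sqrt_pos.2 h0
  have h := Measure.integral_comp_mul_left (fun z => |z| ^ a * |K k z|) (√k)
  have e : ∀ z, |√k * z| ^ a * |K k (√k * z)| = k ^ (a / 2 + c - 1 / 2) * (|z| ^ a * |K 1 z|) := by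
    intro z
    rw [hK, abs_mul, abs_mul, abs_of_pos hs0, Real.mul_rpow hs0.le (abs_nonneg _),
      abs_of_pos (Real.rpow_pos_of_pos h0 _), Real.sqrt_eq_rpow, ← Real.rpow_mul h0.le,
      show a / 2 + c - 1 / 2 = 1 / 2 * a + (c - 1 / 2) by ring, Real.rpow_add h0]
    ring
  simp only [e] at h
  rw [integral_const_mul, abs_of_pos (inv_pos.2 hs0), smul_eq_mul, Real.rpow_sub h0,
    ← Real.sqrt_eq_rpow] at h
  have h2 : √k * _ = √k * _ := congrArg (fun q => √k * q) h
  rw [← mul_assoc, ← mul_assoc, mul_div_cancel₀ _ hs0.ne', mul_inv_cancel₀ hs0.ne', one_mul] at h2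
  exact h2.symm

lemma abs_rpow_le (z a : ℝ) (ha : 0 ≤ a) (ha2 : a ≤ 2) : |z| ^ a ≤ 1 + z ^ 2 := by
  rcases le_total (|z|) 1 with h | h
  · have := Real.rpow_le_one (abs_nonneg z) h ha
    nlinarith [sq_nonneg z]
  · have := Real.rpow_le_rpow_of_exponent_le h ha2
    rw [Real.rpow_two, sq_abs] at this
    linarith

lemma int_dom2 {K : ℝ → ℝ} (hK : Measurable K) {C : ℝ}
    (h : ∀ z, |K z| ≤ C * ((1 + z ^ 2)⁻¹) ^ 2) (a : ℝ) (ha : 0 ≤ a) (ha2 : a ≤ 2) :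
    Integrable (fun z => |z| ^ a * |K z|) := by
  refine int_dom (by fun_prop) (C := C) fun z => ?_
  rw [abs_of_nonneg (by positivity)]
  calc |z| ^ a * |K z| ≤ (1 + z ^ 2) * (C * ((1 + z ^ 2)⁻¹) ^ 2) := by
        gcongr
        · exact abs_rpow_le z a ha ha2
        · exact h z
    _ = _ := by field_simp

lemma hk_int2 (k : ℝ) (h0 : 0 < k) (a : ℝ) (ha : 0 ≤ a) (ha2 : a ≤ 2) :
    Integrable (fun z => |z| ^ a * |hk k z|) ∧ Integrable (fun z => |z| ^ a * |hk1 k z|) ∧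
    Integrable (fun z => |z| ^ a * |hk2 k z|) := by
  obtain ⟨C, -, h⟩ := hk_bounds' k k h0
  have h := h k ⟨le_rfl, le_rfl⟩
  exact ⟨int_dom2 (hk_meas.comp measurable_prodMk_left) (fun z => (h z).1) a ha ha2,
    int_dom2 (hk1_meas.comp measurable_prodMk_left) (fun z => (h z).2.1) a ha ha2,
    int_dom2 (hk2_meas.comp measurable_prodMk_left) (fun z => (h z).2.2) a ha ha2⟩

lemma conv_bound {H K : ℝ → ℝ} {A a x : ℝ}
    (hA : ∀ y, |H y| ≤ A * |x - y| ^ a) (hK : Integrable (fun z => |z| ^ a * |K z|)) :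
    |∫ y, H y * K (x - y)| ≤ A * ∫ z, |z| ^ a * |K z| := by
  have := norm_integral_le_of_norm_le (f := fun y => H y * K (x - y))
    (g := fun y => A * (|x - y| ^ a * |K (x - y)|)) ((hK.comp_sub_left x).const_mul A)
    (Filter.Eventually.of_forall fun y => by
      rw [Real.norm_eq_abs, abs_mul, ← mul_assoc]
      gcongr
      exact hA y)
  rw [integral_const_mul, integral_sub_left_eq_self (fun z => |z| ^ a * |K z|) volume x] at this
  exact this

lemma conv_sub {H K : ℝ → ℝ} {B : ℝ} (hH : Measurable H) (hB : ∀ y, |H y| ≤ B)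
    (hKi : Integrable K) (x c : ℝ) :
    ∫ y, (H y - c) * K (x - y) = (∫ y, H y * K (x - y)) - c * ∫ z, K z := by
  simp only [sub_mul]
  rw [integral_sub (conv_int hH hB hKi x) ((hKi.comp_sub_left x).const_mul c),
    integral_const_mul, integral_sub_left_eq_self K volume x]

/-- bound on first derivative -/
lemma conv1_bound : ∃ M, 0 ≤ M ∧ ∀ (H : ℝ → ℝ) (B x k : ℝ), (∀ y, |H y| ≤ B) → 0 < k →
    |∫ y, H y * hk1 k (x - y)| ≤ B * (k ^ (-(1/2) : ℝ) * M) := by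
  refine ⟨∫ z, |z| ^ (0:ℝ) * |hk1 1 z|, integral_nonneg fun z => by positivity, ?_⟩
  intro H B x k hB h0
  have := conv_bound (H := H) (K := hk1 k) (A := B) (a := 0) (x := x) (by simpa using hB)
    (hk_int2 k h0 0 le_rfl (by norm_num)).2.1
  rw [scale_int (-(1/2)) 0 k h0 (fun w => hk1_scale k w h0)] at this
  simpa using this

lemma conv2_bound (a : ℝ) (ha : 0 ≤ a) (ha2 : a ≤ 2) : ∃ M, 0 ≤ M ∧
    ∀ (H : ℝ → ℝ) (A B x k : ℝ), Measurable H → (∀ y, |H y| ≤ B) →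
    (∀ y, |H y - H x| ≤ A * |x - y| ^ a) → 0 < k →
    |∫ y, H y * hk2 k (x - y)| ≤ A * (k ^ (a / 2 - 1) * M) := by
  refine ⟨∫ z, |z| ^ a * |hk2 1 z|, integral_nonneg fun z => by positivity, ?_⟩
  intro H A B x k hH hB hA h0
  have := conv_bound (H := fun y => H y - H x) (K := hk2 k) hA (hk_int2 k h0 a ha ha2).2.2
  rw [conv_sub hH hB (hk_int k h0).2.2, hk2_integral k h0,
    scale_int (-1) a k h0 (fun w => hk2_scale k w h0)] at this
  simpa [sub_eq_add_neg] using this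

lemma conv0_bound (a : ℝ) (ha : 0 ≤ a) (ha2 : a ≤ 2) : ∃ M, 0 ≤ M ∧
    ∀ (H : ℝ → ℝ) (A B x k : ℝ), Measurable H → (∀ y, |H y| ≤ B) →
    (∀ y, |H y - H x| ≤ A * |x - y| ^ a) → 0 < k →
    |(∫ y, H y * hk k (x - y)) - H x| ≤ A * (k ^ (a / 2) * M) := by
  refine ⟨∫ z, |z| ^ a * |hk 1 z|, integral_nonneg fun z => by positivity, ?_⟩
  intro H A B x k hH hB hA h0
  have := conv_bound (H := fun y => H y - H x) (K := hk k) hA (hk_int2 k h0 a ha ha2).1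
  rw [conv_sub hH hB (hk_int k h0).1, hk_integral k h0,
    scale_int 0 a k h0 (fun w => by rw [hk_scale k w h0, zero_sub])] at this
  simpa using this

lemma conv_B {H : ℝ → ℝ} {B : ℝ} (hB : ∀ y, |H y| ≤ B) (x k : ℝ) (h0 : 0 < k) :
    |∫ y, H y * hk k (x - y)| ≤ B := by
  have := conv_bound (H := H) (K := hk k) (A := B) (a := 0) (x := x) (by simpa using hB)
    (hk_int2 k h0 0 le_rfl (by norm_num)).1
  have e : ∀ z, |z| ^ (0:ℝ) * |hk k z| = hk k z := fun z => by
    rw [Real.rpow_zero, one_mul, abs_of_nonneg (by unfold hk; positivity)]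
  simp only [e, hk_integral k h0, mul_one] at this
  exact this

/-- Fundamental identity. -/
lemma conv_ftc {H : ℝ → ℝ} {A B a x k : ℝ} (hH : Measurable H) (hB : ∀ y, |H y| ≤ B)
    (ha : 0 < a) (ha2 : a ≤ 2) (hA : ∀ y, |H y - H x| ≤ A * |x - y| ^ a) (h0 : 0 < k) :
    ∫ y, H y * hk k (x - y) = H x + ∫ ρ in (0:ℝ)..k, ∫ y, H y * hk2 ρ (x - y) := by
  obtain ⟨M, hM, hM'⟩ := conv2_bound a ha.le ha2
  obtain ⟨M0, hM0, hM0'⟩ := conv0_bound a ha.le ha2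
  have hi : IntervalIntegrable (fun ρ => ∫ y, H y * hk2 ρ (x - y)) volume 0 k := by
    have h1 : IntervalIntegrable (fun ρ : ℝ => A * (ρ ^ (a / 2 - 1) * M)) volume 0 k :=
      ((intervalIntegral.intervalIntegrable_rpow' (by linarith)).mul_const M).const_mul A
    refine h1.mono_fun' ?_ ?_
    · apply StronglyMeasurable.aestronglyMeasurable
      apply StronglyMeasurable.integral_prod_right (f := fun ρ y => H y * hk2 ρ (x - y))
      apply Measurable.stronglyMeasurable
      exact (hH.comp measurable_snd).mul
        (hk2_meas.comp (f := fun q : ℝ × ℝ => (q.1, x - q.2)) (by fun_prop))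
    · rw [Set.uIoc_of_le h0.le]
      filter_upwards [ae_restrict_mem measurableSet_Ioc] with ρ hρ
      exact hM' H A B x ρ hH hB hA hρ.1
  have := intervalIntegral.integral_eq_sub_of_hasDerivAt_of_tendsto h0
    (f := fun k => ∫ y, H y * hk k (x - y)) (fun ρ hρ => conv_deriv_k hH hB x ρ hρ.1) hi
    (fa := H x) (fb := ∫ y, H y * hk k (x - y)) ?_ ?_
  · rw [this]; ring
  · rw [tendsto_iff_norm_sub_tendsto_zero]
    have h2 : Filter.Tendsto (fun ρ : ℝ => A * (ρ ^ (a / 2) * M0)) (nhdsWithin 0 (Set.Ioi 0))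
        (nhds 0) := by
      have : Filter.Tendsto (fun ρ : ℝ => A * (ρ ^ (a / 2) * M0)) (nhds 0)
        (nhds (A * ((0:ℝ) ^ (a / 2) * M0))) :=
        (((Real.continuousAt_rpow_const 0 (a/2) (Or.inr (by linarith))).tendsto).mul_const
          M0).const_mul A
      rw [Real.zero_rpow (by linarith)] at this
      simpa using this.mono_left nhdsWithin_le_nhds
    refine squeeze_zero' (Filter.Eventually.of_forall fun _ => norm_nonneg _) ?_ h2
    filter_upwards [self_mem_nhdsWithin] with ρ hρ
    exact hM0' H A B x ρ hH hB hA hρ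
  · exact ((conv_deriv_k hH hB x k h0).continuousAt.tendsto).mono_left nhdsWithin_le_nhds

lemma time_cont (v : ℝ → ℝ → ℝ) (β C : ℝ) (hβ : 0 < β)
    (hvm : Measurable (Function.uncurry v))
    (hv : ∀ r > 0, ∀ s, |v r s| ≤ C * r ^ (β - 1))
    (hvc : ∀ r > 0, Continuous (v r)) (t : ℝ) (ht : 0 < t) :
    ContinuousAt (fun τ => ∫ s in (0:ℝ)..τ, v (τ - s) s) t := by
  have e : (fun τ => ∫ s in (0:ℝ)..τ, v (τ - s) s) =ᶠ[nhds t]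
      fun τ => ∫ r in Set.Ioc 0 (t + 1), (Set.Iic τ).indicator (fun r => v r (τ - r)) r := by
    filter_upwards [Ioo_mem_nhds ht (lt_add_one t)] with τ hτ
    have h1 := intervalIntegral.integral_comp_sub_left (a := 0) (b := τ) (fun r => v r (τ - r)) τ
    simp only [sub_sub_cancel, sub_self, sub_zero] at h1
    rw [h1, intervalIntegral.integral_of_le hτ.1.le, setIntegral_indicator measurableSet_Iic]
    congr 2
    ext r
    simp only [Set.mem_Ioc, Set.mem_inter_iff, Set.mem_Iic]
    constructor
    · rintro ⟨a, b⟩; exact ⟨⟨a, b.trans hτ.2.le⟩, b⟩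
    · rintro ⟨⟨a, _⟩, b⟩; exact ⟨a, b⟩
  rw [continuousAt_congr e]
  refine continuousAt_of_dominated (bound := fun r => C * r ^ (β - 1)) ?_ ?_ ?_ ?_
  · refine Filter.Eventually.of_forall fun τ => ?_
    apply Measurable.aestronglyMeasurable
    exact (hvm.comp (f := fun r => (r, τ - r)) (by fun_prop)).indicator measurableSet_Iic
  · refine Filter.Eventually.of_forall fun τ => ?_
    filter_upwards [ae_restrict_mem measurableSet_Ioc] with r hr
    refine (norm_indicator_le_norm_self _ _).trans ?_
    exact hv r hr.1 _
  · have : IntervalIntegrable (fun r : ℝ => C * r ^ (β - 1)) volume 0 (t + 1) :=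
      (intervalIntegral.intervalIntegrable_rpow' (by linarith)).const_mul C
    exact (intervalIntegrable_iff_integrableOn_Ioc_of_le (by linarith)).1 this
  · have hne : ∀ᵐ r : ℝ ∂(volume.restrict (Set.Ioc 0 (t + 1))), r ≠ t :=
      ae_restrict_of_ae (by simp [ae_iff])
    filter_upwards [ae_restrict_mem measurableSet_Ioc, hne] with r hr hrt
    rcases lt_or_gt_of_ne hrt with h | h
    · have : (fun τ => (Set.Iic τ).indicator (fun r => v r (τ - r)) r) =ᶠ[nhds t]
          fun τ => v r (τ - r) := by
        filter_upwards [Ioi_mem_nhds h] with τ hτ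
        exact Set.indicator_of_mem (Set.mem_Iic.2 (le_of_lt (Set.mem_Ioi.1 hτ))) _
      rw [continuousAt_congr this]
      exact ((hvc r hr.1).comp (by fun_prop)).continuousAt
    · have : (fun τ => (Set.Iic τ).indicator (fun r => v r (τ - r)) r) =ᶠ[nhds t]
          fun τ => 0 := by
        filter_upwards [Iio_mem_nhds h] with τ hτ
        exact Set.indicator_of_notMem (fun h' => absurd (Set.mem_Iio.1 hτ) (not_lt.2 (Set.mem_Iic.1 h'))) _
      rw [continuousAt_congr this]
      exact continuousAt_const

lemma time_fubini (v : ℝ → ℝ → ℝ) (β C : ℝ) (hβ : 0 < β)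
    (hvm : Measurable (Function.uncurry v))
    (hv : ∀ r > 0, ∀ s, |v r s| ≤ C * r ^ (β - 1)) (t : ℝ) (ht : 0 < t) :
    IntervalIntegrable (fun s => ∫ ρ in (0:ℝ)..(t - s), v ρ s) volume 0 t ∧
    IntervalIntegrable (fun τ => ∫ s in (0:ℝ)..τ, v (τ - s) s) volume 0 t ∧
    ∫ s in (0:ℝ)..t, ∫ ρ in (0:ℝ)..(t - s), v ρ s =
      ∫ τ in (0:ℝ)..t, ∫ s in (0:ℝ)..τ, v (τ - s) s := by
  set S : Set (ℝ × ℝ) := {p | 0 < p.2 ∧ p.2 < p.1 ∧ p.1 ≤ t} with hS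
  have hSm : MeasurableSet S :=
    (measurableSet_lt measurable_const measurable_snd).inter
      ((measurableSet_lt measurable_snd measurable_fst).inter
        (measurableSet_le measurable_fst measurable_const))
  set w : ℝ × ℝ → ℝ := S.indicator (fun p => v (p.1 - p.2) p.2) with hw
  have hwm : Measurable w :=
    (hvm.comp (f := fun p : ℝ × ℝ => (p.1 - p.2, p.2)) (by fun_prop)).indicator hSm
  have hwi : Integrable w (volume.prod volume) := by
    have h1 : Integrable ((Set.Ioc (0:ℝ) t).indicator (fun _ => (1:ℝ))) :=
      (integrable_indicator_iff measurableSet_Ioc).2 (by simp)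
    have h2 : Integrable ((Set.Ioc (0:ℝ) t).indicator (fun r => C * r ^ (β - 1))) := by
      refine (integrable_indicator_iff measurableSet_Ioc).2 ?_
      have : IntervalIntegrable (fun r : ℝ => C * r ^ (β - 1)) volume 0 t :=
        (intervalIntegral.intervalIntegrable_rpow' (by linarith)).const_mul C
      exact (intervalIntegrable_iff_integrableOn_Ioc_of_le (by linarith)).1 this
    have h3 := h1.convolution_integrand (ContinuousLinearMap.mul ℝ ℝ) h2
    refine h3.norm.mono' hwm.aestronglyMeasurable (Filter.Eventually.of_forall fun p => ?_)
    by_cases hp : p ∈ S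
    · have hp' := hp
      obtain ⟨a, b, c⟩ := hp'
      have m1 : p.2 ∈ Set.Ioc 0 t := ⟨a, b.le.trans c⟩
      have m2 : p.1 - p.2 ∈ Set.Ioc 0 t := ⟨by linarith, by linarith⟩
      rw [hw, Set.indicator_of_mem hp, Set.indicator_of_mem m1, Set.indicator_of_mem m2]
      simp only [ContinuousLinearMap.mul_apply', one_mul]
      exact (hv _ m2.1 _).trans (le_abs_self _)
    · rw [hw, Set.indicator_of_notMem hp, norm_zero]
      exact norm_nonneg _
  have hswap := integral_integral_swap (f := fun τ s => w (τ, s)) hwi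
  have hL : (fun s => ∫ τ, w (τ, s)) =ᵐ[volume] (Set.Ioc 0 t).indicator
      (fun s => ∫ ρ in (0:ℝ)..(t - s), v ρ s) := by
    refine Filter.Eventually.of_forall fun s => ?_
    by_cases hs : s ∈ Set.Ioc 0 t
    · rw [Set.indicator_of_mem hs]
      have e : ∀ τ, w (τ, s) = (Set.Ioc s t).indicator (fun τ => v (τ - s) s) τ := by
        intro τ
        by_cases h : τ ∈ Set.Ioc s t
        · rw [Set.indicator_of_mem h, hw, Set.indicator_of_mem]
          exact ⟨hs.1, h.1, h.2⟩
        · rw [Set.indicator_of_notMem h, hw, Set.indicator_of_notMem]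
          exact fun h' => h ⟨h'.2.1, h'.2.2⟩
      simp only [e]
      rw [integral_indicator measurableSet_Ioc, ← intervalIntegral.integral_of_le hs.2,
        intervalIntegral.integral_comp_sub_right (fun ρ => v ρ s), sub_self]
    · rw [Set.indicator_of_notMem hs]
      have e : ∀ τ, w (τ, s) = 0 := by
        intro τ
        rw [hw, Set.indicator_of_notMem]
        exact fun h' => hs ⟨h'.1, h'.2.1.le.trans h'.2.2⟩
      simp only [e, integral_zero]
  have hR : (fun τ => ∫ s, w (τ, s)) =ᵐ[volume] (Set.Ioc 0 t).indicator
      (fun τ => ∫ s in (0:ℝ)..τ, v (τ - s) s) := by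
    refine Filter.Eventually.of_forall fun τ => ?_
    by_cases hs : τ ∈ Set.Ioc 0 t
    · rw [Set.indicator_of_mem hs]
      have e : ∀ s, w (τ, s) = (Set.Ioo 0 τ).indicator (fun s => v (τ - s) s) s := by
        intro s
        by_cases h : s ∈ Set.Ioo 0 τ
        · rw [Set.indicator_of_mem h, hw, Set.indicator_of_mem]
          exact ⟨h.1, h.2, hs.2⟩
        · rw [Set.indicator_of_notMem h, hw, Set.indicator_of_notMem]
          exact fun h' => h ⟨h'.1, h'.2.1⟩
      simp only [e]
      rw [integral_indicator measurableSet_Ioo, ← integral_Ioc_eq_integral_Ioo,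
        ← intervalIntegral.integral_of_le hs.1.le]
    · rw [Set.indicator_of_notMem hs]
      have e : ∀ s, w (τ, s) = 0 := by
        intro s
        rw [hw, Set.indicator_of_notMem]
        exact fun h' => hs ⟨h'.1.trans h'.2.1, h'.2.2⟩
      simp only [e, integral_zero]
  refine ⟨?_, ?_, ?_⟩
  · rw [intervalIntegrable_iff_integrableOn_Ioc_of_le ht.le,
      ← integrable_indicator_iff measurableSet_Ioc]
    exact (hwi.integral_prod_right).congr hL
  · rw [intervalIntegrable_iff_integrableOn_Ioc_of_le ht.le,
      ← integrable_indicator_iff measurableSet_Ioc]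
    exact (hwi.integral_prod_left).congr hR
  · rw [integral_congr_ae hL, integral_congr_ae hR, integral_indicator measurableSet_Ioc,
      integral_indicator measurableSet_Ioc, ← intervalIntegral.integral_of_le ht.le,
      ← intervalIntegral.integral_of_le ht.le] at hswap
    exact hswap.symm

lemma time_deriv (U v : ℝ → ℝ → ℝ) (G : ℝ → ℝ) (β C : ℝ) (hβ : 0 < β) (hG : Continuous G)
    (hvm : Measurable (Function.uncurry v))
    (hv : ∀ r > 0, ∀ s, |v r s| ≤ C * r ^ (β - 1))
    (hvc : ∀ r > 0, Continuous (v r))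
    (hU : ∀ r > 0, ∀ s, U r s = G s + ∫ ρ in (0:ℝ)..r, v ρ s) (t : ℝ) (ht : 0 < t) :
    HasDerivAt (fun τ => ∫ s in (0:ℝ)..τ, U (τ - s) s)
      (G t + ∫ s in (0:ℝ)..t, v (t - s) s) t := by
  have key : ∀ τ > 0, ∫ s in (0:ℝ)..τ, U (τ - s) s =
      (∫ s in (0:ℝ)..τ, G s) + ∫ τ' in (0:ℝ)..τ, ∫ s in (0:ℝ)..τ', v (τ' - s) s := by
    intro τ hτ
    obtain ⟨h1, h2, h3⟩ := time_fubini v β C hβ hvm hv τ hτ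
    rw [← h3, ← intervalIntegral.integral_add (hG.intervalIntegrable _ _) h1]
    rw [intervalIntegral.integral_of_le hτ.le, intervalIntegral.integral_of_le hτ.le,
      integral_Ioc_eq_integral_Ioo, integral_Ioc_eq_integral_Ioo]
    refine setIntegral_congr_fun measurableSet_Ioo fun s hs => ?_
    exact hU _ (sub_pos.2 hs.2) s
  have e : (fun τ => ∫ s in (0:ℝ)..τ, U (τ - s) s) =ᶠ[nhds t] fun τ =>
      (∫ s in (0:ℝ)..τ, G s) + ∫ τ' in (0:ℝ)..τ, ∫ s in (0:ℝ)..τ', v (τ' - s) s := by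
    filter_upwards [Ioi_mem_nhds ht] with τ hτ using key τ hτ
  refine HasDerivAt.congr_of_eventuallyEq ?_ e
  refine (intervalIntegral.integral_hasDerivAt_right (hG.intervalIntegrable _ _)
    (hG.stronglyMeasurableAtFilter _ _) hG.continuousAt).add ?_
  refine intervalIntegral.integral_hasDerivAt_right (time_fubini v β C hβ hvm hv t ht).2.1 ?_
    (time_cont v β C hβ hvm hv hvc t ht)
  refine ContinuousOn.stronglyMeasurableAtFilter (s := Set.Ioi 0) isOpen_Ioi
    (fun τ hτ => (time_cont v β C hβ hvm hv hvc τ hτ).continuousWithinAt) t ht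

lemma rpow_ii (ϑ t c : ℝ) (hϑ : 0 < ϑ) (ht : 0 < t) (hc : -1 < c) :
    IntervalIntegrable (fun s => (ϑ * (t - s)) ^ c) volume 0 t := by
  have h1 : IntervalIntegrable (fun r : ℝ => (ϑ * r) ^ c) volume 0 t := by
    have : IntervalIntegrable (fun r : ℝ => ϑ ^ c * r ^ c) volume 0 t :=
      (intervalIntegral.intervalIntegrable_rpow' hc).const_mul _
    refine this.congr ?_
    rw [Set.uIoc_of_le ht.le]
    intro r hr
    exact (Real.mul_rpow hϑ.le hr.1.le).symm
  have := (h1.comp_sub_left t)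
  simp only [sub_zero, sub_self] at this
  exact this.symm

lemma conv_smeas {G K : ℝ → ℝ → ℝ} (hG : Measurable (Function.uncurry G))
    (hK : Measurable (fun q : ℝ × ℝ => K q.1 q.2)) (ϑ t z : ℝ) :
    Measurable (fun s => ∫ y, G s y * K (ϑ * (t - s)) (z - y)) := by
  apply StronglyMeasurable.measurable
  apply StronglyMeasurable.integral_prod_right
    (f := fun s y => G s y * K (ϑ * (t - s)) (z - y))
  apply Measurable.stronglyMeasurable
  exact hG.mul (hK.comp (f := fun q : ℝ × ℝ => (ϑ * (t - q.1), z - q.2)) (by fun_prop))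

lemma space_deriv (G : ℝ → ℝ → ℝ) (hG : Measurable (Function.uncurry G)) (B A γ ϑ t x δ : ℝ)
    (hB : ∀ s y, |G s y| ≤ B) (hγ : 0 < γ) (hγ2 : γ ≤ 2) (hϑ : 0 < ϑ) (ht : 0 < t) (hδ : 0 < δ)
    (hA : ∀ s, ∀ z ∈ Metric.ball x δ, ∀ y, |G s y - G s z| ≤ A * |z - y| ^ γ) :
    deriv (deriv (fun z => ∫ s in (0:ℝ)..t, ∫ y, G s y * hk (ϑ * (t - s)) (z - y))) x =
      ∫ s in (0:ℝ)..t, ∫ y, G s y * hk2 (ϑ * (t - s)) (x - y) := by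
  have hGs : ∀ s, Measurable (G s) := fun s => hG.comp measurable_prodMk_left
  obtain ⟨M1, hM1, hM1'⟩ := conv1_bound
  obtain ⟨M2, hM2, hM2'⟩ := conv2_bound γ hγ.le hγ2
  have hne : ∀ᵐ s : ℝ, s ≠ t := by simp [ae_iff]
  have hb1 : IntervalIntegrable (fun s => B * ((ϑ * (t - s)) ^ (-(1/2) : ℝ) * M1)) volume 0 t :=
    ((rpow_ii ϑ t _ hϑ ht (by norm_num)).mul_const _).const_mul _
  have hb2 : IntervalIntegrable (fun s => A * ((ϑ * (t - s)) ^ (γ / 2 - 1) * M2)) volume 0 t :=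
    ((rpow_ii ϑ t _ hϑ ht (by linarith)).mul_const _).const_mul _
  have hpos : ∀ s, s ∈ Set.uIoc 0 t → s ≠ t → 0 < ϑ * (t - s) := by
    intro s hs hst
    rw [Set.uIoc_of_le ht.le] at hs
    exact mul_pos hϑ (sub_pos.2 (lt_of_le_of_ne hs.2 hst))
  have d1 : ∀ z, HasDerivAt (fun z => ∫ s in (0:ℝ)..t, ∫ y, G s y * hk (ϑ * (t - s)) (z - y))
      (∫ s in (0:ℝ)..t, ∫ y, G s y * hk1 (ϑ * (t - s)) (z - y)) z := by
    intro z
    refine (intervalIntegral.hasDerivAt_integral_of_dominated_loc_of_deriv_le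
      (F := fun z s => ∫ y, G s y * hk (ϑ * (t - s)) (z - y))
      (F' := fun z s => ∫ y, G s y * hk1 (ϑ * (t - s)) (z - y))
      (s := Set.univ) Filter.univ_mem
      (Filter.Eventually.of_forall fun w => (conv_smeas hG hk_meas ϑ t w).aestronglyMeasurable)
      ?_ (conv_smeas hG hk1_meas ϑ t z).aestronglyMeasurable ?_ hb1 ?_).2
    · refine (intervalIntegrable_const (c := B)).mono_fun'
        (conv_smeas hG hk_meas ϑ t z).aestronglyMeasurable ?_
      filter_upwards [ae_restrict_mem measurableSet_uIoc, ae_restrict_of_ae hne] with s hs hst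
      exact conv_B (hB s) z _ (hpos s hs hst)
    · filter_upwards [hne] with s hst hs w _
      exact hM1' (G s) B w _ (hB s) (hpos s hs hst)
    · filter_upwards [hne] with s hst hs w _
      have h0 := hpos s hs hst
      obtain ⟨C, -, hC⟩ := hk_bounds _ _ h0
      exact conv_deriv (hGs s) (hB s) (fun z => hk_deriv _ z h0) (hk_int _ h0).1
        (hk1_meas.comp measurable_prodMk_left) (fun z => (hC _ ⟨le_rfl, le_rfl⟩ z).2.1) w
  have e : deriv (fun z => ∫ s in (0:ℝ)..t, ∫ y, G s y * hk (ϑ * (t - s)) (z - y)) =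
      fun z => ∫ s in (0:ℝ)..t, ∫ y, G s y * hk1 (ϑ * (t - s)) (z - y) :=
    funext fun z => (d1 z).deriv
  rw [e]
  refine HasDerivAt.deriv ?_
  refine (intervalIntegral.hasDerivAt_integral_of_dominated_loc_of_deriv_le
      (F := fun z s => ∫ y, G s y * hk1 (ϑ * (t - s)) (z - y))
      (F' := fun z s => ∫ y, G s y * hk2 (ϑ * (t - s)) (z - y))
      (s := Metric.ball x δ) (Metric.ball_mem_nhds x hδ)
      (Filter.Eventually.of_forall fun w => (conv_smeas hG hk1_meas ϑ t w).aestronglyMeasurable)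
      ?_ (conv_smeas hG hk2_meas ϑ t x).aestronglyMeasurable ?_ hb2 ?_).2
  · refine hb1.mono_fun'
      (conv_smeas hG hk1_meas ϑ t x).aestronglyMeasurable ?_
    filter_upwards [ae_restrict_mem measurableSet_uIoc, ae_restrict_of_ae hne] with s hs hst
    exact hM1' (G s) B x _ (hB s) (hpos s hs hst)
  · filter_upwards [hne] with s hst hs w hw
    exact hM2' (G s) A B w _ (hGs s) (hB s) (hA s w hw) (hpos s hs hst)
  · filter_upwards [hne] with s hst hs w _
    have h0 := hpos s hs hst
    obtain ⟨C, -, hC⟩ := hk_bounds _ _ h0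
    exact conv_deriv (hGs s) (hB s) (fun z => hk1_deriv _ z h0) (hk_int _ h0).2.1
      (hk2_meas.comp measurable_prodMk_left) (fun z => (hC _ ⟨le_rfl, le_rfl⟩ z).2.2) w

lemma main_G (G : ℝ → ℝ → ℝ) (hGc : Continuous (Function.uncurry G)) (B A γ ϑ t x δ : ℝ)
    (hB : ∀ s y, |G s y| ≤ B) (hγ : 0 < γ) (hγ2 : γ ≤ 2) (hϑ : 0 < ϑ) (ht : 0 < t) (hδ : 0 < δ)
    (hA : ∀ s, ∀ z ∈ Metric.ball x δ, ∀ y, |G s y - G s z| ≤ A * |z - y| ^ γ) :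
    HasDerivAt (fun τ => ∫ s in (0:ℝ)..τ, ∫ y, G s y * hk (ϑ * (τ - s)) (x - y))
      (G t x + ϑ * deriv (deriv (fun z => ∫ s in (0:ℝ)..t, ∫ y, G s y * hk (ϑ * (t - s)) (z - y))) x)
      t := by
  have hG := hGc.measurable
  have hGs : ∀ s, Measurable (G s) := fun s => hG.comp measurable_prodMk_left
  rw [space_deriv G hG B A γ ϑ t x δ hB hγ hγ2 hϑ ht hδ hA, ← intervalIntegral.integral_const_mul]
  obtain ⟨M2, hM2, hM2'⟩ := conv2_bound γ hγ.le hγ2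
  have hx : ∀ s y, |G s y - G s x| ≤ A * |x - y| ^ γ :=
    fun s y => hA s x (Metric.mem_ball_self hδ) y
  refine time_deriv (fun r s => ∫ y, G s y * hk (ϑ * r) (x - y))
    (fun r s => ϑ * ∫ y, G s y * hk2 (ϑ * r) (x - y)) (fun s => G s x) (γ / 2)
    (ϑ * (A * (ϑ ^ (γ / 2 - 1) * M2))) (by linarith) ?_ ?_ ?_ ?_ ?_ t ht
  · exact hGc.comp (f := fun s => (s, x)) (by fun_prop)
  · apply Measurable.const_mul
    apply StronglyMeasurable.measurable
    apply StronglyMeasurable.integral_prod_right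
      (f := fun (q : ℝ × ℝ) y => G q.2 y * hk2 (ϑ * q.1) (x - y))
    apply Measurable.stronglyMeasurable
    exact (hG.comp (f := fun q : (ℝ × ℝ) × ℝ => (q.1.2, q.2)) (by fun_prop)).mul
      (hk2_meas.comp (f := fun q : (ℝ × ℝ) × ℝ => (ϑ * q.1.1, x - q.2)) (by fun_prop))
  · intro r hr s
    have := hM2' (G s) A B x (ϑ * r) (hGs s) (hB s) (hx s) (mul_pos hϑ hr)
    rw [abs_mul, abs_of_pos hϑ]
    rw [Real.mul_rpow hϑ.le (le_of_lt hr)] at this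
    calc _ ≤ ϑ * (A * (ϑ ^ (γ / 2 - 1) * r ^ (γ / 2 - 1) * M2)) := by gcongr
      _ = _ := by ring
  · intro r hr
    have hr : 0 < ϑ * r := mul_pos hϑ hr
    refine continuous_const.mul ?_
    refine MeasureTheory.continuous_of_dominated (bound := fun y => B * |hk2 (ϑ * r) (x - y)|) ?_ ?_ ?_ ?_
    · exact fun s => (conv_int (hGs s) (hB s) (hk_int _ hr).2.2 x).aestronglyMeasurable
    · intro s
      refine Filter.Eventually.of_forall fun y => ?_
      rw [Real.norm_eq_abs, abs_mul]
      gcongr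
      exact hB s y
    · exact (((hk_int _ hr).2.2.comp_sub_left x).abs).const_mul B
    · refine Filter.Eventually.of_forall fun y => ?_
      exact (hGc.comp (f := fun s => (s, y)) (by fun_prop)).mul continuous_const
  · intro r hr s
    rw [conv_ftc (hGs s) (hB s) hγ hγ2 (hx s) (mul_pos hϑ hr), intervalIntegral.integral_const_mul,
      intervalIntegral.mul_integral_comp_mul_left (f := fun ρ => ∫ y, G s y * hk2 ρ (x - y)), mul_zero]

instance fact_two_pos : Fact ((0:ℝ) < 2) := ⟨two_pos⟩

lemma summable_gauss (k : ℝ) (h0 : 0 < k) :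
    Summable (fun n : ℤ => Real.exp (-(π ^ 2 * (n:ℝ) ^ 2 * k))) := by
  obtain ⟨C, hC, h⟩ := gauss_dom (π ^ 2 * k) (by positivity)
  have hs : Summable (fun n : ℤ => C * (1 / (n:ℝ) ^ 2)) :=
    (Real.summable_one_div_int_pow.2 (by norm_num)).mul_left C
  refine hs.of_norm_bounded_eventually ?_
  filter_upwards [(Set.finite_singleton (0:ℤ)).compl_mem_cofinite] with n hn
  have hn : (n:ℝ) ≠ 0 := by exact_mod_cast hn
  have hn2 : 0 < (n:ℝ) ^ 2 := by positivity
  rw [Real.norm_eq_abs, abs_of_pos (Real.exp_pos _), mul_one_div, le_div_iff₀ hn2]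
  refine le_trans ?_ (h n)
  rw [show π ^ 2 * (n:ℝ) ^ 2 * k = π ^ 2 * k * (n:ℝ) ^ 2 by ring, mul_comm]
  gcongr
  nlinarith [sq_nonneg ((n:ℝ)^2)]

lemma norm_fourierCoeff_le (f : C(AddCircle (2:ℝ), ℂ)) (n : ℤ) : ‖fourierCoeff f n‖ ≤ ‖f‖ := by
  unfold fourierCoeff
  refine (norm_integral_le_of_norm_le_const (C := ‖f‖)
    (Filter.Eventually.of_forall fun t => ?_)).trans ?_
  · rw [norm_smul, fourier_apply, Circle.norm_coe, one_mul]
    exact f.norm_coe_le_norm t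
  · simp

lemma fourier_summand_bound (f : C(AddCircle (2:ℝ), ℂ)) (k x : ℝ) (n : ℤ) :
    ‖(Real.exp (-(π ^ 2 * (n:ℝ) ^ 2 * k)) : ℂ) * fourierCoeff f n
      * fourier n (x : AddCircle (2:ℝ))‖ ≤ Real.exp (-(π ^ 2 * (n:ℝ) ^ 2 * k)) * ‖f‖ := by
  rw [norm_mul, norm_mul, fourier_apply, Circle.norm_coe, mul_one, Complex.norm_real,
    Real.norm_eq_abs, abs_of_pos (Real.exp_pos _)]
  gcongr
  exact norm_fourierCoeff_le f n

lemma fourier_summable (f : C(AddCircle (2:ℝ), ℂ)) (k x : ℝ) (h0 : 0 < k) :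
    Summable (fun n : ℤ => (Real.exp (-(π ^ 2 * (n:ℝ) ^ 2 * k)) : ℂ) * fourierCoeff f n
      * fourier n (x : AddCircle (2:ℝ))) :=
  Summable.of_norm_bounded ((summable_gauss k h0).mul_right ‖f‖)
    (fourier_summand_bound f k x)

lemma gauss_conv_int (f : C(AddCircle (2:ℝ), ℂ)) (k x : ℝ) (h0 : 0 < k) :
    Integrable (fun y : ℝ => f (y : AddCircle (2:ℝ)) * (hk k (x - y) : ℂ)) := by
  refine (((hk_int k h0).1.comp_sub_left x).ofReal (𝕜 := ℂ)).bdd_mul (c := ‖f‖)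
    (Continuous.aestronglyMeasurable ?_) ?_
  · exact f.continuous.comp (AddCircle.continuous_mk' _)
  · exact Filter.Eventually.of_forall fun y => f.norm_coe_le_norm _

lemma gauss_conv_bound (f : C(AddCircle (2:ℝ), ℂ)) (k x : ℝ) (h0 : 0 < k) :
    ‖∫ y : ℝ, f (y : AddCircle (2:ℝ)) * (hk k (x - y) : ℂ)‖ ≤ 1 * ‖f‖ := by
  have := norm_integral_le_of_norm_le (f := fun y : ℝ => f (y : AddCircle (2:ℝ)) * (hk k (x - y) : ℂ))
    (g := fun y => ‖f‖ * hk k (x - y)) (((hk_int k h0).1.comp_sub_left x).const_mul _)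
    (Filter.Eventually.of_forall fun y => by
      rw [norm_mul, Complex.norm_real, Real.norm_eq_abs,
        abs_of_nonneg (by unfold hk; positivity : 0 ≤ hk k (x - y))]
      have : 0 ≤ hk k (x - y) := by unfold hk; positivity
      gcongr
      exact f.norm_coe_le_norm _)
  rw [integral_const_mul, integral_sub_left_eq_self (hk k) volume x, hk_integral k h0] at this
  linarith

noncomputable def fL1 (k x : ℝ) (h0 : 0 < k) : C(AddCircle (2:ℝ), ℂ) →L[ℂ] ℂ :=
  LinearMap.mkContinuous
    { toFun := fun f => ∫ y : ℝ, f (y : AddCircle (2:ℝ)) * (hk k (x - y) : ℂ)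
      map_add' := fun f g => by
        simp only [ContinuousMap.add_apply, add_mul]
        exact integral_add (gauss_conv_int f k x h0) (gauss_conv_int g k x h0)
      map_smul' := fun c f => by
        simp only [ContinuousMap.smul_apply, smul_eq_mul, mul_assoc, RingHom.id_apply]
        exact integral_const_mul _ _ } 1 (fun f => gauss_conv_bound f k x h0)

noncomputable def fL2 (k x : ℝ) (h0 : 0 < k) : C(AddCircle (2:ℝ), ℂ) →L[ℂ] ℂ :=
  LinearMap.mkContinuous
    { toFun := fun f => ∑' n : ℤ, (Real.exp (-(π ^ 2 * (n:ℝ) ^ 2 * k)) : ℂ) * fourierCoeff f n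
        * fourier n (x : AddCircle (2:ℝ))
      map_add' := fun f g => by
        rw [← (fourier_summable f k x h0).tsum_add (fourier_summable g k x h0)]
        refine tsum_congr fun n => ?_
        have := congrFun (fourierCoeff.add (f := (f : AddCircle (2:ℝ) → ℂ)) (g := g)
          (f.continuous.integrable_of_hasCompactSupport (HasCompactSupport.of_compactSpace _))
          (g.continuous.integrable_of_hasCompactSupport (HasCompactSupport.of_compactSpace _))) n
        rw [ContinuousMap.coe_add, this, Pi.add_apply]
        ring
      map_smul' := fun c f => by
        rw [RingHom.id_apply, smul_eq_mul, ← tsum_mul_left]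
        refine tsum_congr fun n => ?_
        rw [ContinuousMap.coe_smul, fourierCoeff.const_smul, smul_eq_mul]
        ring }
    (∑' n : ℤ, Real.exp (-(π ^ 2 * (n:ℝ) ^ 2 * k)))
    (fun f => by
      rw [← tsum_mul_right]
      exact tsum_of_norm_bounded ((summable_gauss k h0).mul_right ‖f‖).hasSum
        (fourier_summand_bound f k x))

lemma gauss_fourier (k x : ℝ) (h0 : 0 < k) (m : ℤ) :
    ∫ y : ℝ, fourier m (y : AddCircle (2:ℝ)) * (hk k (x - y) : ℂ) =
      (Real.exp (-(π ^ 2 * (m:ℝ) ^ 2 * k)) : ℂ) * fourier m (x : AddCircle (2:ℝ)) := by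
  have h1 := integral_sub_left_eq_self
    (fun y : ℝ => fourier m (y : AddCircle (2:ℝ)) * (hk k (x - y) : ℂ)) volume x
  rw [← h1]
  simp only [sub_sub_cancel]
  have hg := fourierIntegral_gaussian (b := ((1 / (4 * k) : ℝ) : ℂ))
    (by rw [Complex.ofReal_re]; positivity) (((-(π * m) : ℝ) : ℂ))
  have e : ∀ y : ℝ, fourier m ((x - y : ℝ) : AddCircle (2:ℝ)) * (hk k y : ℂ) =
      ((√(4 * π * k))⁻¹ : ℝ) * fourier m (x : AddCircle (2:ℝ)) *
      (Complex.exp (Complex.I * ((-(π * m) : ℝ) : ℂ) * y) *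
        Complex.exp (-((1 / (4 * k) : ℝ) : ℂ) * y ^ 2)) := by
    intro y
    rw [fourier_coe_apply, fourier_coe_apply, hk]
    rw [Complex.ofReal_mul, Complex.ofReal_exp]
    have : Complex.exp (2 * π * Complex.I * m * ((x - y : ℝ) : ℂ) / ((2:ℝ):ℂ)) =
      Complex.exp (2 * π * Complex.I * m * x / ((2:ℝ):ℂ)) *
        Complex.exp (Complex.I * ((-(π * m) : ℝ) : ℂ) * y) := by
      rw [← Complex.exp_add]
      congr 1
      push_cast
      ring
    rw [this]
    have : ((-(y ^ 2 / (4 * k)) : ℝ) : ℂ) = -((1 / (4 * k) : ℝ) : ℂ) * y ^ 2 := by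
      push_cast; ring
    rw [this]
    ring
  simp only [e]
  rw [integral_const_mul, hg]
  have e2 : ((π : ℂ) / ((1 / (4 * k) : ℝ) : ℂ)) ^ (1 / 2 : ℂ) = ((√(4 * π * k) : ℝ) : ℂ) := by
    rw [Real.sqrt_eq_rpow, Complex.ofReal_cpow (by positivity)]
    have : ((π : ℂ) / ((1 / (4 * k) : ℝ) : ℂ)) = ((4 * π * k : ℝ) : ℂ) := by
      rw [← Complex.ofReal_div]
      congr 1
      field_simp
    rw [this]
    norm_num
  have e3 : Complex.exp (-((-(π * m) : ℝ) : ℂ) ^ 2 / (4 * ((1 / (4 * k) : ℝ) : ℂ))) =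
      (Real.exp (-(π ^ 2 * (m:ℝ) ^ 2 * k)) : ℂ) := by
    rw [Complex.ofReal_exp]
    congr 1
    have : (k : ℂ) ≠ 0 := by exact_mod_cast h0.ne'
    push_cast
    field_simp
  rw [e2, e3, Complex.ofReal_inv]
  have : ((√(4 * π * k) : ℝ) : ℂ) ≠ 0 := by
    exact_mod_cast (Real.sqrt_pos.2 (by positivity)).ne'
  field_simp

lemma fourier_heat (f : C(AddCircle (2:ℝ), ℂ)) (k x : ℝ) (h0 : 0 < k) :
    ∫ y : ℝ, f (y : AddCircle (2:ℝ)) * (hk k (x - y) : ℂ) =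
    ∑' n : ℤ, (Real.exp (-(π ^ 2 * (n:ℝ) ^ 2 * k)) : ℂ) * fourierCoeff f n
        * fourier n (x : AddCircle (2:ℝ)) := by
  have : fL1 k x h0 = fL2 k x h0 := by
    refine ContinuousLinearMap.ext_on (s := Set.range (@fourier (2:ℝ))) ?_ ?_
    · rw [Submodule.dense_iff_topologicalClosure_eq_top]
      exact span_fourier_closure_eq_top
    · rintro _ ⟨m, rfl⟩
      change (∫ y : ℝ, fourier m (y : AddCircle (2:ℝ)) * (hk k (x - y) : ℂ)) = 
        ∑' n : ℤ, (Real.exp (-(π ^ 2 * (n:ℝ) ^ 2 * k)) : ℂ) * fourierCoeff (fourier m) n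
        * fourier n (x : AddCircle (2:ℝ))
      rw [gauss_fourier k x h0 m, fourierCoeff_fourier, tsum_eq_single m]
      · simp
      · intro n hn
        simp [Pi.single_apply, hn]
  exact congrArg (fun L => L f) this

noncomputable def foldD (y : ℝ) : ℝ := Real.arccos (Real.cos (π * y)) / π

lemma foldD_mem (y : ℝ) : foldD y ∈ Set.Icc (0:ℝ) 1 :=
  ⟨div_nonneg (Real.arccos_nonneg _) pi_pos.le,
    (div_le_one pi_pos).2 (Real.arccos_le_pi _)⟩

lemma foldD_eq {y : ℝ} (hy : y ∈ Set.Icc (0:ℝ) 1) : foldD y = y := by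
  unfold foldD
  rw [Real.arccos_cos (mul_nonneg pi_pos.le hy.1) (by nlinarith [pi_pos, hy.2])]
  field_simp

lemma foldD_cont : Continuous foldD := by
  unfold foldD
  exact (Real.continuous_arccos.comp (by fun_prop)).div_const _

lemma foldD_neg (y : ℝ) : foldD (-y) = foldD y := by
  unfold foldD; rw [mul_neg, Real.cos_neg]

lemma foldD_add (y : ℝ) : foldD (y + 2) = foldD y := by
  unfold foldD; rw [mul_add, mul_comm π 2, Real.cos_add_two_pi]

lemma foldD_sin {y : ℝ} (h : Real.sin (π * y) = 0) : foldD y = 0 ∨ foldD y = 1 := by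
  have h1 : (Real.cos (π * y)) ^ 2 = 1 := by
    have := Real.sin_sq_add_cos_sq (π * y); rw [h] at this; linarith
  rcases mul_self_eq_one_iff.1 ((sq (Real.cos (π * y))).symm.trans h1) with h2 | h2 <;> unfold foldD <;> rw [h2]
  · left; simp
  · right; rw [Real.arccos_neg_one]; exact div_self pi_pos.ne'

noncomputable def gE (g : ℝ → ℝ → ℝ) (s y : ℝ) : ℝ :=
  if 0 ≤ Real.sin (π * y) then g (max s 0) (foldD y) else -g (max s 0) (foldD y)

section ext
variable {g : ℝ → ℝ → ℝ} {B : ℝ}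

lemma gE_zero (hbdry : ∀ s : ℝ, 0 ≤ s → g s 0 = 0 ∧ g s 1 = 0) (s : ℝ) {y : ℝ}
    (h : Real.sin (π * y) = 0) : g (max s 0) (foldD y) = 0 := by
  rcases foldD_sin h with h | h <;> rw [h]
  · exact (hbdry _ (le_max_right _ _)).1
  · exact (hbdry _ (le_max_right _ _)).2

lemma gE_cont (hcont : ContinuousOn (fun q : ℝ × ℝ => g q.1 q.2) (Set.Ici 0 ×ˢ Set.Icc 0 1))
    (hbdry : ∀ s : ℝ, 0 ≤ s → g s 0 = 0 ∧ g s 1 = 0) : Continuous (Function.uncurry (gE g)) := by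
  have h1 : Continuous (fun q : ℝ × ℝ => g (max q.1 0) (foldD q.2)) := by
    refine hcont.comp_continuous (f := fun q : ℝ × ℝ => (max q.1 0, foldD q.2)) ?_ ?_
    · exact (continuous_fst.max continuous_const).prodMk (foldD_cont.comp continuous_snd)
    · exact fun q => Set.mk_mem_prod (Set.mem_Ici.2 (le_max_right q.1 0)) (foldD_mem q.2)
  refine Continuous.if_le h1 h1.neg continuous_const (by fun_prop) ?_
  intro q hq
  rw [gE_zero hbdry q.1 hq.symm, neg_zero]

lemma gE_bound (hbound : ∀ s : ℝ, 0 ≤ s → ∀ x ∈ Set.Icc (0 : ℝ) 1, |g s x| ≤ B) (s y : ℝ) :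
    |gE g s y| ≤ B := by
  unfold gE
  have := hbound _ (le_max_right s 0) _ (foldD_mem y)
  split_ifs
  · exact this
  · rwa [abs_neg]

lemma gE_per (s : ℝ) : Function.Periodic (gE g s) 2 := by
  intro y
  unfold gE
  rw [foldD_add, mul_add, mul_comm π 2, Real.sin_add_two_pi]

lemma gE_eq (s : ℝ) {y : ℝ} (hy : y ∈ Set.Icc (0:ℝ) 1) : gE g s y = g (max s 0) y := by
  unfold gE
  rw [foldD_eq hy, if_pos]
  exact Real.sin_nonneg_of_nonneg_of_le_pi (mul_nonneg pi_pos.le hy.1)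
    (by nlinarith [pi_pos, hy.2])

lemma gE_odd (hbdry : ∀ s : ℝ, 0 ≤ s → g s 0 = 0 ∧ g s 1 = 0) (s y : ℝ) :
    gE g s (-y) = -gE g s y := by
  unfold gE
  rw [foldD_neg, mul_neg, Real.sin_neg]
  rcases lt_trichotomy (Real.sin (π * y)) 0 with h | h | h
  · rw [if_pos (by linarith), if_neg (by linarith), neg_neg]
  · rw [gE_zero hbdry s h]; simp
  · rw [if_neg (by linarith), if_pos (by linarith)]

lemma gE_holder (γ' : ℝ) (hγ : 0 < γ')
    (hbound : ∀ s : ℝ, 0 ≤ s → ∀ x ∈ Set.Icc (0 : ℝ) 1, |g s x| ≤ B)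
    (hHolder : ∀ s : ℝ, 0 ≤ s → ∀ x ∈ Set.Icc (0 : ℝ) 1, ∀ y ∈ Set.Icc (0 : ℝ) 1,
      |g s x - g s y| ≤ B * |x - y| ^ γ') (x : ℝ) (hx : x ∈ Set.Ioo (0:ℝ) 1) :
    ∃ δ > 0, ∃ A, ∀ s, ∀ z ∈ Metric.ball x δ, ∀ y, |gE g s y - gE g s z| ≤ A * |z - y| ^ γ' := by
  obtain ⟨δ, hδ, h1, h2⟩ : ∃ δ > 0, 2 * δ ≤ x ∧ 2 * δ ≤ 1 - x :=
    ⟨min x (1 - x) / 2, by have := hx.1; have := sub_pos.2 hx.2; positivity,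
      by linarith [min_le_left x (1 - x)], by linarith [min_le_right x (1 - x)]⟩
  have hB0 : 0 ≤ B := (abs_nonneg _).trans (hbound 0 le_rfl 0 ⟨le_rfl, zero_le_one⟩)
  refine ⟨δ, hδ, B + 2 * B / δ ^ γ', fun s z hz y => ?_⟩
  have hz := abs_lt.1 (show |z - x| < δ from hz)
  have hδp : 0 < δ ^ γ' := Real.rpow_pos_of_pos hδ _
  rw [add_mul]
  have hzI : z ∈ Set.Icc (0:ℝ) 1 := ⟨by linarith, by linarith⟩
  have p1 : 0 ≤ B * |z - y| ^ γ' := by positivity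
  have p2 : 0 ≤ 2 * B / δ ^ γ' * |z - y| ^ γ' := by positivity
  rcases lt_or_ge (|z - y|) δ with h | h
  · have h' := abs_lt.1 h
    have hyI : y ∈ Set.Icc (0:ℝ) 1 := ⟨by linarith, by linarith⟩
    rw [gE_eq s hyI, gE_eq s hzI, abs_sub_comm]
    have := hHolder (max s 0) (le_max_right _ _) z hzI y hyI
    linarith
  · have h3 : δ ^ γ' ≤ |z - y| ^ γ' := Real.rpow_le_rpow hδ.le h hγ.le
    have h4 : 2 * B ≤ 2 * B / δ ^ γ' * |z - y| ^ γ' := by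
      rw [div_mul_eq_mul_div, le_div_iff₀ hδp]
      gcongr
    have h5 := (abs_sub (gE g s y) (gE g s z)).trans
      (add_le_add (gE_bound hbound s y) (gE_bound hbound s z))
    linarith

noncomputable def gC (hc : Continuous (Function.uncurry (gE g))) (s : ℝ) :
    C(AddCircle (2:ℝ), ℂ) where
  toFun := Function.Periodic.lift (f := fun y => (gE g s y : ℂ)) (c := (2:ℝ))
    (fun y => by simp only [gE_per s y])
  continuous_toFun := by
    apply Continuous.quotient_liftOn'
    exact Complex.continuous_ofReal.comp (hc.comp (f := fun y => (s, y)) (by fun_prop))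

lemma gC_coe (hc : Continuous (Function.uncurry (gE g))) (s y : ℝ) :
    gC hc s (y : AddCircle (2:ℝ)) = (gE g s y : ℂ) := rfl

lemma gC_coeff (hc : Continuous (Function.uncurry (gE g)))
    (hbdry : ∀ s : ℝ, 0 ≤ s → g s 0 = 0 ∧ g s 1 = 0) (s : ℝ) (n : ℤ) :
    fourierCoeff (gC hc s) n =
      -Complex.I * ((∫ y in (0:ℝ)..1, gE g s y * Real.sin (π * n * y) : ℝ) : ℂ) := by
  have hcs : Continuous (gE g s) := hc.comp (f := fun y => (s, y)) (by fun_prop)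
  rw [fourierCoeff_eq_intervalIntegral _ n (-1), show (-1:ℝ) + 2 = 1 by norm_num]
  set h : ℝ → ℂ := fun y => fourier (-n) (y : AddCircle (2:ℝ)) • gC hc s (y : AddCircle (2:ℝ)) with hh
  have hcont : Continuous h :=
    ((fourier (-n)).continuous.comp (AddCircle.continuous_mk' _)).smul
      ((gC hc s).continuous.comp (AddCircle.continuous_mk' _))
  have i1 : ∫ y in (-1:ℝ)..0, h y = ∫ y in (0:ℝ)..1, h (-y) := by
    rw [intervalIntegral.integral_comp_neg]; simp
  have hcn : Continuous (fun y => h (-y)) := hcont.comp continuous_neg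
  rw [← intervalIntegral.integral_add_adjacent_intervals (b := 0) (hcont.intervalIntegrable _ _)
    (hcont.intervalIntegrable _ _), i1, ← intervalIntegral.integral_add
    (hcn.intervalIntegrable _ _) (hcont.intervalIntegrable _ _)]
  have e : ∀ y : ℝ, h (-y) + h y =
      (-2 * Complex.I) * ((gE g s y * Real.sin (π * n * y) : ℝ) : ℂ) := by
    intro y
    simp only [hh, gC_coe, gE_odd hbdry, fourier_coe_apply, smul_eq_mul]
    have a1 : 2 * (π:ℂ) * Complex.I * ((-n : ℤ) : ℂ) * ((-y : ℝ) : ℂ) / ((2:ℝ):ℂ) =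
      ((π * n * y : ℝ) : ℂ) * Complex.I := by push_cast; ring
    have a2 : 2 * (π:ℂ) * Complex.I * ((-n : ℤ) : ℂ) * ((y : ℝ) : ℂ) / ((2:ℝ):ℂ) =
      ((-(π * n * y) : ℝ) : ℂ) * Complex.I := by push_cast; ring
    rw [a1, a2, Complex.exp_mul_I, Complex.exp_mul_I, ← Complex.ofReal_cos, ← Complex.ofReal_sin,
      ← Complex.ofReal_cos, ← Complex.ofReal_sin, Real.cos_neg, Real.sin_neg]
    push_cast
    ring
  simp only [e]
  rw [intervalIntegral.integral_const_mul, intervalIntegral.integral_ofReal, Complex.real_smul]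
  push_cast
  ring

lemma series_eq (hcont : ContinuousOn (fun q : ℝ × ℝ => g q.1 q.2) (Set.Ici 0 ×ˢ Set.Icc 0 1))
    (hbdry : ∀ s : ℝ, 0 ≤ s → g s 0 = 0 ∧ g s 1 = 0) (ϑ : ℝ) (hϑ : 0 < ϑ) (r s x : ℝ)
    (hr : 0 < r) (hs : 0 ≤ s) :
    ∑' ℓ : ℕ, Real.exp (-(ϑ * Real.pi ^ 2 * ((ℓ : ℝ) + 1) ^ 2 * r))
      * fCoef g (ℓ + 1) s * sineB (ℓ + 1) x = ∫ y, gE g s y * hk (ϑ * r) (x - y) := by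
  have hc := gE_cont hcont hbdry
  have h0 : 0 < ϑ * r := mul_pos hϑ hr
  have h1 := fourier_heat (gC hc s) (ϑ * r) x h0
  have hsum := fourier_summable (gC hc s) (ϑ * r) x h0
  simp only [gC_coe, gC_coeff hc hbdry, ← Complex.ofReal_mul] at h1 hsum
  rw [integral_complex_ofReal] at h1
  have h2 := congrArg Complex.re h1
  rw [Complex.re_tsum hsum, Complex.ofReal_re] at h2
  set S : ℤ → ℝ := fun n => ∫ y in (0:ℝ)..1, gE g s y * Real.sin (π * n * y) with hS
  set F : ℤ → ℝ := fun n => Real.exp (-(π ^ 2 * (n:ℝ) ^ 2 * (ϑ * r))) * S n *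
    Real.sin (π * n * x) with hF
  have e : ∀ n : ℤ, ((Real.exp (-(π ^ 2 * (n:ℝ) ^ 2 * (ϑ * r))) : ℂ) * (-Complex.I * (S n : ℂ))
        * fourier n (x : AddCircle (2:ℝ))).re = F n := by
    intro n
    rw [fourier_coe_apply]
    have a1 : 2 * (π:ℂ) * Complex.I * (n : ℂ) * (x : ℂ) / ((2:ℝ):ℂ) =
      ((π * n * x : ℝ) : ℂ) * Complex.I := by push_cast; ring
    rw [a1, Complex.exp_mul_I, ← Complex.ofReal_cos, ← Complex.ofReal_sin]
    have : (Real.exp (-(π ^ 2 * (n:ℝ) ^ 2 * (ϑ * r))) : ℂ) * (-Complex.I * (S n : ℂ)) *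
      ((Real.cos (π * n * x) : ℂ) + (Real.sin (π * n * x) : ℂ) * Complex.I) =
      (F n : ℂ) + ((-(Real.exp (-(π ^ 2 * (n:ℝ) ^ 2 * (ϑ * r))) * S n * Real.cos (π * n * x)) : ℝ) : ℂ)
        * Complex.I := by
      simp only [hF]
      push_cast
      linear_combination (-(Complex.exp (-(π ^ 2 * (n:ℂ) ^ 2 * (ϑ * r))) * (S n : ℂ) *
        Complex.sin (π * n * x))) * Complex.I_sq
    rw [this, Complex.add_re, Complex.ofReal_re, Complex.re_ofReal_mul, Complex.I_re, mul_zero,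
      add_zero]
  have hsumF : Summable F := by
    have := (Complex.hasSum_re hsum.hasSum).summable
    exact this.congr fun n => (e n)
  have hFe : Function.Even F := by
    intro n
    simp only [hF, hS]
    push_cast
    simp only [mul_neg, neg_mul, Real.sin_neg, neg_sq, intervalIntegral.integral_neg, neg_neg]
  rw [h2, tsum_congr e, tsum_int_eq_zero_add_two_mul_tsum_pnat hFe hsumF,
    tsum_pnat_eq_tsum_succ (f := fun n : ℕ => F n)]
  have hF0 : F 0 = 0 := by simp [hF]
  rw [hF0, zero_add, nsmul_eq_mul, ← tsum_mul_left]
  refine tsum_congr fun ℓ => ?_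
  have hS2 : fCoef g (ℓ + 1) s = √2 * S ((ℓ + 1 : ℕ) : ℤ) := by
    unfold fCoef
    simp only [hS]
    rw [← intervalIntegral.integral_const_mul]
    refine intervalIntegral.integral_congr fun y hy => ?_
    rw [Set.uIcc_of_le zero_le_one] at hy
    simp only [gE_eq s hy, max_eq_left hs, sineB]
    push_cast
    ring
  rw [hS2]
  simp only [hF, sineB]
  have h22 : √2 * √2 = (2:ℝ) := Real.mul_self_sqrt (by norm_num)
  push_cast
  rw [show π ^ 2 * ((ℓ:ℝ) + 1) ^ 2 * (ϑ * r) = ϑ * π ^ 2 * ((ℓ : ℝ) + 1) ^ 2 * r by ring]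
  linear_combination (Real.exp (-(ϑ * π ^ 2 * ((ℓ : ℝ) + 1) ^ 2 * r)) * S ((ℓ:ℤ) + 1) *
    Real.sin (π * (ℓ + 1) * x)) * h22

lemma heatConv_eq (hcont : ContinuousOn (fun q : ℝ × ℝ => g q.1 q.2) (Set.Ici 0 ×ˢ Set.Icc 0 1))
    (hbdry : ∀ s : ℝ, 0 ≤ s → g s 0 = 0 ∧ g s 1 = 0) (ϑ : ℝ) (hϑ : 0 < ϑ) (t x : ℝ)
    (ht : 0 < t) :
    heatConv ϑ g t x = ∫ s in (0:ℝ)..t, ∫ y, gE g s y * hk (ϑ * (t - s)) (x - y) := by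
  unfold heatConv
  rw [intervalIntegral.integral_of_le ht.le, intervalIntegral.integral_of_le ht.le,
      integral_Ioc_eq_integral_Ioo, integral_Ioc_eq_integral_Ioo]
  refine setIntegral_congr_fun measurableSet_Ioo fun s hs => ?_
  exact series_eq hcont hbdry ϑ hϑ (t - s) s x (sub_pos.2 hs.2) hs.1.le

end ext

/-- Differentiated mild-solution identity: for spatially `γ̃`-Hölder continuous, bounded,
continuous `g` vanishing on the lateral boundary, the heat convolution `N` satisfies, for
every `x ∈ (0,1)` and every `t > 0`, `∂ₜN(t,x) = g(t,x) + ϑ·∂²ₓN(t,x)`. -/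
theorem heatConv_time_derivative (ϑ γ' : ℝ) (hϑ : 0 < ϑ)
    (hγ' : γ' ∈ Set.Ioo (0 : ℝ) (1 / 2)) (g : ℝ → ℝ → ℝ) (B : ℝ)
    (hcont : ContinuousOn (fun q : ℝ × ℝ => g q.1 q.2) (Set.Ici 0 ×ˢ Set.Icc 0 1))
    (hbdry : ∀ s : ℝ, 0 ≤ s → g s 0 = 0 ∧ g s 1 = 0)
    (hbound : ∀ s : ℝ, 0 ≤ s → ∀ x ∈ Set.Icc (0 : ℝ) 1, |g s x| ≤ B)
    (hHolder : ∀ s : ℝ, 0 ≤ s → ∀ x ∈ Set.Icc (0 : ℝ) 1, ∀ y ∈ Set.Icc (0 : ℝ) 1,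
      |g s x - g s y| ≤ B * |x - y| ^ γ') :
    ∀ x ∈ Set.Ioo (0 : ℝ) 1, ∀ t > (0 : ℝ),
      HasDerivAt (fun τ => heatConv ϑ g τ x)
        (g t x + ϑ * deriv (deriv (fun z => heatConv ϑ g t z)) x) t := by
  intro x hx t ht
  obtain ⟨δ, hδ, A, hA⟩ := gE_holder γ' hγ'.1 hbound hHolder x hx
  have h := main_G (gE g) (gE_cont hcont hbdry) B A γ' ϑ t x δ (gE_bound hbound) hγ'.1
    (by linarith [hγ'.2]) hϑ ht hδ hA
  have e1 : (fun z => heatConv ϑ g t z) = fun z => ∫ s in (0:ℝ)..t, ∫ y, gE g s y *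
      hk (ϑ * (t - s)) (z - y) := funext fun z => heatConv_eq hcont hbdry ϑ hϑ t z ht
  rw [e1]
  rw [gE_eq t ⟨hx.1.le, hx.2.le⟩, max_eq_left ht.le] at h
  refine h.congr_of_eventuallyEq ?_
  filter_upwards [Ioi_mem_nhds ht] with τ hτ
  exact heatConv_eq hcont hbdry ϑ hϑ τ x hτ
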